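/- Let X be a compact Hausdorff space, α : X → X a continuous map, and A : C(X) → C(X) a transfer operator for (X, α). Then for every α-invariant regular Borel probability measure μ on X, the t-entropy of μ satisfies τ(μ) = inf_{n ∈ ℕ, D} (1/n) Σ_{g ∈ D} μ(g) · ln( μ(Aⁿg) / μ(g) ), where the infimum is taken over all positive integers n and all continuous partitions of unity D on X (i.e., in the definition of τ(μ) the supremum over measures m may be replaced by evaluating at m = μ). -/

import Mathlib

open scoped BigOperators

/-- The summand `μ(g) · ln(m(Aⁿg)/μ(g))` with the conventions: it is `0` whenever
`μ(g) = 0` (regardless of `m(Aⁿg)`), and it is `−∞` when `μ(g) > 0` but `m(Aⁿg) = 0`. -/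
noncomputable def tSummand (a b : ℝ) : EReal :=
  if a = 0 then 0 else if b = 0 then ⊥ else ((a * Real.log (b / a) : ℝ) : EReal)

/-- A continuous partition of unity on `X`: a finite set of nonnegative continuous
real-valued functions summing to `1`. -/
def IsPartitionOfUnity {X : Type*} [TopologicalSpace X] (D : Finset C(X, ℝ)) : Prop :=
  (∀ g ∈ D, 0 ≤ g) ∧ ∑ g ∈ D, g = 1

/-- A positive normalized linear functional on `C(X, ℝ)` (a regular Borel probability
measure, via the Riesz representation theorem). -/
def IsPosNormalized {X : Type*} [TopologicalSpace X] (μ : C(X, ℝ) →ₗ[ℝ] ℝ) : Prop :=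
  (∀ f : C(X, ℝ), 0 ≤ f → 0 ≤ μ f) ∧ μ 1 = 1

/-- `τ_n(μ) = inf_D sup_m Σ_{g ∈ D} μ(g) ln(m(Aⁿg)/μ(g))`. -/
noncomputable def tauN {X : Type*} [TopologicalSpace X] [CompactSpace X] [T2Space X]
    (A : C(X, ℝ) →ₗ[ℝ] C(X, ℝ)) (μ : C(X, ℝ) →ₗ[ℝ] ℝ) (n : ℕ) : EReal :=
  ⨅ (D : Finset C(X, ℝ)) (_ : IsPartitionOfUnity D),
    ⨆ (m : C(X, ℝ) →ₗ[ℝ] ℝ) (_ : IsPosNormalized m),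
      ∑ g ∈ D, tSummand (μ g) (m ((A ^ n) g))

/-- The `t`-entropy `τ(μ) = inf_{n ≥ 1} τ_n(μ)/n`. -/
noncomputable def tEntropy {X : Type*} [TopologicalSpace X] [CompactSpace X] [T2Space X]
    (A : C(X, ℝ) →ₗ[ℝ] C(X, ℝ)) (μ : C(X, ℝ) →ₗ[ℝ] ℝ) : EReal :=
  ⨅ n : ℕ+, ((((n : ℕ) : ℝ))⁻¹ : EReal) * tauN A μ (n : ℕ)

lemma tSummand_double (a b : ℝ) : tSummand a b + tSummand a b = tSummand (a + a) (b + b) := by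
  unfold tSummand
  by_cases ha : a = 0
  · simp [ha]
  have ha2 : a + a ≠ 0 := by intro h; apply ha; linarith
  by_cases hb : b = 0
  · simp [ha, ha2, hb]
  have hb2 : b + b ≠ 0 := by intro h; apply hb; linarith
  rw [if_neg ha, if_neg ha2, if_neg hb, if_neg hb2, ← EReal.coe_add]
  have : (b + b) / (a + a) = b / a := by field_simp
  rw [this]; congr 1; ring

lemma tSummand_ne_top (a b : ℝ) : tSummand a b ≠ ⊤ := by
  unfold tSummand
  split_ifs
  · exact EReal.zero_ne_top
  · exact bot_ne_top
  · exact EReal.coe_ne_top _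

lemma tSummand_le {a b c : ℝ} (ha : 0 ≤ a) (hb : 0 ≤ b) (hc : 0 ≤ c) (hac : a ≠ 0 → 0 < c) :
    tSummand a b ≤ ((b * c - a - a * Real.log c : ℝ) : EReal) := by
  unfold tSummand
  split_ifs with h1 h2
  · subst h1
    have : 0 ≤ b * c := mul_nonneg hb hc
    exact_mod_cast (by simpa using this)
  · exact bot_le
  · rw [EReal.coe_le_coe_iff]
    have ha' : 0 < a := lt_of_le_of_ne ha (Ne.symm h1)
    have hb' : 0 < b := lt_of_le_of_ne hb (Ne.symm h2)
    have hc' := hac h1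
    have h := Real.log_le_sub_one_of_pos (x := b / a * c) (by positivity)
    rw [Real.log_mul (by positivity) (by positivity)] at h
    have h' := mul_le_mul_of_nonneg_left h ha
    have e : a * (b / a * c - 1) = b * c - a := by field_simp
    rw [e] at h'
    linarith

/-- Multisets of nonnegative functions summing to one can be turned into partitions of unity. -/
lemma exists_partition_of_multiset {X : Type*} [TopologicalSpace X] :
    ∀ (k : ℕ) (s : Multiset C(X, ℝ)), Multiset.card s = k → (∀ g ∈ s, 0 ≤ g) → s.sum = 1 →
      ∃ D : Finset C(X, ℝ), IsPartitionOfUnity D ∧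
        ∀ Φ : C(X, ℝ) → EReal, (∀ g, Φ g + Φ g = Φ (g + g)) → ∑ g ∈ D, Φ g = (s.map Φ).sum := by
  intro k
  induction k with
  | zero =>
    intro s hs h0 h1
    have hs' : s.Nodup := by rw [Multiset.card_eq_zero.1 hs]; exact Multiset.nodup_zero
    exact ⟨⟨s, hs'⟩, ⟨fun g hg => h0 g hg, by simpa [Finset.sum] using h1⟩, fun Φ _ => rfl⟩
  | succ k ih =>
    intro s hs h0 h1
    by_cases hn : s.Nodup
    · exact ⟨⟨s, hn⟩, ⟨fun g hg => h0 g hg, by simpa [Finset.sum] using h1⟩, fun Φ _ => rfl⟩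
    · rw [Multiset.nodup_iff_ne_cons_cons] at hn
      push Not at hn
      obtain ⟨a, t, rfl⟩ := hn
      have ha : 0 ≤ a := h0 a (by simp)
      obtain ⟨D, hD, hΦ⟩ := ih ((a + a) ::ₘ t) (by simpa using hs)
        (by
          intro g hg
          rcases Multiset.mem_cons.1 hg with rfl | hg
          · exact add_nonneg ha ha
          · exact h0 g (by simp [hg]))
        (by simpa [add_assoc] using h1)
      refine ⟨D, hD, fun Φ h => ?_⟩
      rw [hΦ Φ h]
      simp [← h, add_assoc]

/-- Partition of unity subordinate to level sets. -/
lemma exists_levels {X : Type*} [TopologicalSpace X] [CompactSpace X] (w : C(X, ℝ)) (hw : 0 ≤ w)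
    {δ : ℝ} (hδ : 0 < δ) :
    ∃ (K : ℕ) (h : ℕ → C(X, ℝ)) (d : ℕ → ℝ), (∀ j, 0 ≤ h j) ∧ (∀ j, 0 < d j) ∧
      ∑ j ∈ Finset.range K, h j = 1 ∧ (∀ j, h j * w ≤ d j • h j) ∧
      (∀ j, d j • h j ≤ h j * (w + (2 * δ) • (1 : C(X, ℝ)))) := by
  let φ : ℕ → C(X, ℝ) := fun j =>
    ⟨fun x => min 1 (max 0 (w x / δ - j + 1)), by fun_prop⟩
  obtain ⟨K, hK⟩ := exists_nat_gt (‖w‖ / δ + 1)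
  have key : ∀ j x, (0 ≤ φ j x - φ (j+1) x) ∧
      (φ j x - φ (j+1) x = 0 ∨ (w x ≤ (j + 1) * δ ∧ (j + 1) * δ ≤ w x + 2 * δ)) := by
    intro j x
    have e : w x = (w x / δ) * δ := by field_simp
    simp only [φ, ContinuousMap.coe_mk]
    push_cast
    generalize w x / δ = u at *
    constructor
    · rw [sub_nonneg]
      apply min_le_min le_rfl
      apply max_le_max le_rfl
      linarith
    · rcases le_total (u) (j - 1) with h | h
      · left
        rw [max_eq_left (by linarith), max_eq_left (by linarith)]; simp
      rcases le_total (j + 1 : ℝ) u with h' | h'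
      · left
        rw [max_eq_right (by linarith), max_eq_right (by linarith), min_eq_left (by linarith),
          min_eq_left (by linarith)]; simp
      · right
        rw [e]
        constructor <;> nlinarith
  refine ⟨K, fun j => φ j - φ (j+1), fun j => (j + 1) * δ, ?_, ?_, ?_, ?_, ?_⟩
  · intro j x
    exact (key j x).1
  · intro j; positivity
  · rw [Finset.sum_range_sub' φ K]
    ext x
    have hx : 0 ≤ w x := hw x
    have hx2 : w x ≤ ‖w‖ := (le_abs_self _).trans (w.norm_coe_le_norm x)
    have h0 : 0 ≤ w x / δ := by positivity
    have h1 : w x / δ ≤ ‖w‖ / δ := by gcongr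
    simp only [φ, ContinuousMap.coe_mk, ContinuousMap.sub_apply, ContinuousMap.one_apply]
    rw [min_eq_left (by rw [le_max_iff]; right; push_cast; linarith),
      max_eq_left (by linarith)]
    simp
  · intro j x
    have := key j x
    change (φ j x - φ (j+1) x) * w x ≤ ((j + 1) * δ) * (φ j x - φ (j+1) x)
    rcases this with ⟨h0, h | ⟨h1, h2⟩⟩
    · rw [h]; simp
    · nlinarith
  · intro j x
    have := key j x
    change ((j + 1) * δ) * (φ j x - φ (j+1) x) ≤ (φ j x - φ (j+1) x) * (w x + (2 * δ) * 1)
    rcases this with ⟨h0, h | ⟨h1, h2⟩⟩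
    · rw [h]; simp
    · nlinarith

lemma coe_sum_EReal {ι : Type*} (s : Finset ι) (f : ι → ℝ) :
    ((∑ i ∈ s, f i : ℝ) : EReal) = ∑ i ∈ s, (f i : EReal) := by
  classical
  induction s using Finset.induction_on with
  | empty => simp
  | insert a s ha ih => rw [Finset.sum_insert ha, Finset.sum_insert ha, EReal.coe_add, ih]

lemma pos_mono {X : Type*} [TopologicalSpace X] {m : C(X, ℝ) →ₗ[ℝ] ℝ} (hm : IsPosNormalized m)
    {f g : C(X, ℝ)} (h : f ≤ g) : m f ≤ m g := by
  have := hm.1 (g - f) (sub_nonneg.2 h)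
  rw [map_sub] at this
  linarith

lemma main_bound {X : Type*} [TopologicalSpace X] [CompactSpace X]
    (β : C(X, X)) (B : C(X, ℝ) →ₗ[ℝ] C(X, ℝ))
    (hB_pos : ∀ f : C(X, ℝ), 0 ≤ f → 0 ≤ B f)
    (hB_hom : ∀ f g : C(X, ℝ), B ((f.comp β) * g) = f * B g)
    (μ : C(X, ℝ) →ₗ[ℝ] ℝ) (hμ : IsPosNormalized μ)
    (hμinv : ∀ f : C(X, ℝ), μ (f.comp β) = μ f)
    (D : Finset C(X, ℝ)) (hD : IsPartitionOfUnity D) {δ : ℝ} (hδ : 0 < δ) :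
    ∃ D' : Finset C(X, ℝ), IsPartitionOfUnity D' ∧ ∀ m : C(X, ℝ) →ₗ[ℝ] ℝ, IsPosNormalized m →
      ∑ g ∈ D', tSummand (μ g) (m (B g)) ≤
        ((∑ g ∈ D, μ g * Real.log ((μ (B g) + δ) / μ g) + 2 * δ : ℝ) : EReal) := by
  classical
  have hg0 : ∀ g ∈ D, 0 ≤ μ g := fun g hg => hμ.1 g (hD.1 g hg)
  have hBg0 : ∀ g ∈ D, 0 ≤ μ (B g) := fun g hg => hμ.1 _ (hB_pos g (hD.1 g hg))
  let c : C(X, ℝ) → ℝ := fun g => μ g / (μ (B g) + δ)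
  have hc0 : ∀ g ∈ D, 0 ≤ c g := fun g hg =>
    div_nonneg (hg0 g hg) (by have := hBg0 g hg; linarith)
  have hμD : ∑ g ∈ D, μ g = 1 := by rw [← map_sum, hD.2, hμ.2]
  let w : C(X, ℝ) := ∑ g ∈ D, c g • B g
  have hw : 0 ≤ w := Finset.sum_nonneg fun g hg => smul_nonneg (hc0 g hg) (hB_pos g (hD.1 g hg))
  have hμw : μ w ≤ 1 := by
    rw [← hμD, map_sum]
    apply Finset.sum_le_sum
    intro g hg
    have h1 := hg0 g hg
    have h2 := hBg0 g hg
    simp only [map_smul, smul_eq_mul, c]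
    rw [div_mul_eq_mul_div, div_le_iff₀ (by linarith)]
    nlinarith
  obtain ⟨K, h, d, hh0, hd0, hsum, hlow, hup⟩ := exists_levels w hw hδ
  let F : C(X, ℝ) × ℕ → C(X, ℝ) := fun p => (h p.2).comp β * p.1
  have hhc0 : ∀ j, 0 ≤ (h j).comp β := fun j x => hh0 j (β x)
  have hF0 : ∀ p ∈ D ×ˢ Finset.range K, 0 ≤ F p := by
    intro p hp
    exact mul_nonneg (hhc0 _) (hD.1 _ (Finset.mem_product.1 hp).1)
  have hsumc : ∑ j ∈ Finset.range K, (h j).comp β = 1 := by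
    ext x
    have := congrArg (fun f : C(X, ℝ) => f (β x)) hsum
    simpa [ContinuousMap.sum_apply] using this
  have hFg : ∀ g, ∑ j ∈ Finset.range K, F (g, j) = g := by
    intro g
    simp only [F]
    rw [← Finset.sum_mul, hsumc, one_mul]
  have hFj : ∀ j, ∑ g ∈ D, F (g, j) = (h j).comp β := by
    intro j
    simp only [F]
    rw [← Finset.mul_sum, hD.2, mul_one]
  have hFsum : ∑ p ∈ D ×ˢ Finset.range K, F p = 1 := by
    rw [Finset.sum_product]
    simp only [hFg]
    exact hD.2
  obtain ⟨D', hD', hΦ⟩ := exists_partition_of_multiset _ ((D ×ˢ Finset.range K).val.map F) rfl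
    (by
      intro g hg
      obtain ⟨p, hp, rfl⟩ := Multiset.mem_map.1 hg
      exact hF0 p hp) hFsum
  refine ⟨D', hD', fun m hm => ?_⟩
  rw [hΦ (fun g => tSummand (μ g) (m (B g)))
    (fun g => by simp only [map_add]; exact tSummand_double _ _), Multiset.map_map]
  change ∑ p ∈ D ×ˢ Finset.range K, tSummand (μ (F p)) (m (B (F p))) ≤ _
  have hterm : ∀ p ∈ D ×ˢ Finset.range K, tSummand (μ (F p)) (m (B (F p))) ≤
      ((m (B (F p)) * (c p.1 / d p.2) - μ (F p) - μ (F p) * Real.log (c p.1)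
        + μ (F p) * (d p.2 - 1) : ℝ) : EReal) := by
    intro p hp
    have hp1 := (Finset.mem_product.1 hp).1
    have hp2 := (Finset.mem_product.1 hp).2
    have hμF := hμ.1 _ (hF0 p hp)
    have hmF := hm.1 _ (hB_pos _ (hF0 p hp))
    have hle : μ (F p) ≤ μ p.1 := by
      apply pos_mono hμ
      conv_rhs => rw [← hFg p.1]
      exact Finset.single_le_sum (f := fun j => F (p.1, j))
        (fun j hj => hF0 (p.1, j) (Finset.mem_product.2 ⟨hp1, hj⟩)) hp2
    have hcpos : μ (F p) ≠ 0 → 0 < c p.1 := by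
      intro hne
      have : 0 < μ (F p) := lt_of_le_of_ne hμF (Ne.symm hne)
      have h2 := hBg0 _ hp1
      exact div_pos (by linarith) (by linarith)
    refine (tSummand_le hμF hmF (div_nonneg (hc0 _ hp1) (hd0 p.2).le)
      (fun hne => div_pos (hcpos hne) (hd0 p.2))).trans ?_
    rw [EReal.coe_le_coe_iff]
    by_cases hne : μ (F p) = 0
    · rw [hne]; simp
    · rw [Real.log_div (hcpos hne).ne' (hd0 p.2).ne']
      have := mul_le_mul_of_nonneg_left (Real.log_le_sub_one_of_pos (hd0 p.2)) hμF
      linarith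
  refine (Finset.sum_le_sum hterm).trans ?_
  rw [← coe_sum_EReal, EReal.coe_le_coe_iff, Finset.sum_add_distrib, Finset.sum_sub_distrib,
    Finset.sum_sub_distrib]
  have e1 : ∑ p ∈ D ×ˢ Finset.range K, m (B (F p)) * (c p.1 / d p.2) ≤ 1 := by
    rw [Finset.sum_product_right]
    have : ∀ j ∈ Finset.range K, ∑ g ∈ D, m (B (F (g, j))) * (c g / d j) ≤ m (h j) := by
      intro j _
      have e : ∑ g ∈ D, m (B (F (g, j))) * (c g / d j) = m (h j * w) / d j := by
        simp only [F, hB_hom, w, Finset.mul_sum, map_sum, Finset.sum_div, mul_smul_comm, map_smul,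
          smul_eq_mul]
        apply Finset.sum_congr rfl
        intro g _
        ring
      rw [e, div_le_iff₀ (hd0 j)]
      have := pos_mono hm (hlow j)
      rw [map_smul, smul_eq_mul] at this
      linarith
    refine (Finset.sum_le_sum this).trans ?_
    rw [← map_sum, hsum, hm.2]
  have e2 : ∑ p ∈ D ×ˢ Finset.range K, μ (F p) = 1 := by
    rw [← map_sum, hFsum, hμ.2]
  have e3 : ∑ p ∈ D ×ˢ Finset.range K, μ (F p) * Real.log (c p.1) =
      - ∑ g ∈ D, μ g * Real.log ((μ (B g) + δ) / μ g) := by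
    rw [Finset.sum_product, ← Finset.sum_neg_distrib]
    apply Finset.sum_congr rfl
    intro g _
    simp only
    rw [← Finset.sum_mul, ← map_sum, hFg, ← mul_neg, ← Real.log_inv, inv_div]
  have e4 : ∑ p ∈ D ×ˢ Finset.range K, μ (F p) * (d p.2 - 1) ≤ 2 * δ := by
    simp only [mul_sub, mul_one]
    rw [Finset.sum_sub_distrib, e2, Finset.sum_product_right]
    have : ∀ j ∈ Finset.range K, ∑ g ∈ D, μ (F (g, j)) * d j ≤
        μ (h j * (w + (2 * δ) • (1 : C(X, ℝ)))) := by
      intro j _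
      rw [← Finset.sum_mul, ← map_sum, hFj, hμinv]
      have := pos_mono hμ (hup j)
      rw [map_smul, smul_eq_mul] at this
      linarith
    have h2 := Finset.sum_le_sum this
    rw [← map_sum, ← Finset.sum_mul, hsum, one_mul, map_add, map_smul, hμ.2, smul_eq_mul] at h2
    simp only at h2 ⊢
    linarith
  linarith

open Filter Topology in
lemma tendsto_tSummand {a b : ℝ} (ha : 0 ≤ a) (hb : 0 ≤ b) :
    Tendsto (fun δ : ℝ => ((a * Real.log ((b + δ) / a) : ℝ) : EReal)) (𝓝[>] 0)
      (𝓝 (tSummand a b)) := by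
  unfold tSummand
  split_ifs with h1 h2
  · subst h1; simp
  · subst h2
    have ha' : 0 < a := lt_of_le_of_ne ha (Ne.symm h1)
    rw [EReal.tendsto_coe_nhds_bot_iff]
    apply Tendsto.const_mul_atBot ha'
    apply Real.tendsto_log_nhdsGT_zero.comp
    rw [tendsto_nhdsWithin_iff]
    constructor
    · have : Tendsto (fun δ : ℝ => (0 + δ) / a) (𝓝 0) (𝓝 ((0 + 0) / a)) :=
        Continuous.tendsto (by fun_prop) 0
      simpa using this.mono_left nhdsWithin_le_nhds
    · filter_upwards [self_mem_nhdsWithin] with δ hδ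
      have : 0 < δ := hδ
      simp only [Set.mem_Ioi]
      positivity
  · have ha' : 0 < a := lt_of_le_of_ne ha (Ne.symm h1)
    have hb' : 0 < b := lt_of_le_of_ne hb (Ne.symm h2)
    rw [EReal.tendsto_coe]
    have : ContinuousAt (fun δ : ℝ => a * Real.log ((b + δ) / a)) 0 := by
      apply ContinuousAt.mul continuousAt_const
      apply ContinuousAt.log
      · fun_prop
      · simp [h1, h2]
    have h3 := this.tendsto
    simp only [add_zero] at h3
    exact h3.mono_left nhdsWithin_le_nhds

open Filter Topology in
lemma tendsto_sum_EReal {ι T : Type*} {l : Filter T} (s : Finset ι) (f : ι → T → EReal) (a : ι → EReal)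
    (ha : ∀ i, a i ≠ ⊤) (hf : ∀ i ∈ s, Tendsto (f i) l (𝓝 (a i))) :
    Tendsto (fun t => ∑ i ∈ s, f i t) l (𝓝 (∑ i ∈ s, a i)) ∧ ∑ i ∈ s, a i ≠ ⊤ := by
  classical
  induction s using Finset.induction_on with
  | empty => simpa using tendsto_const_nhds
  | insert i s hi ih =>
    obtain ⟨h1, h2⟩ := ih (fun j hj => hf j (Finset.mem_insert_of_mem hj))
    simp only [Finset.sum_insert hi]
    refine ⟨?_, EReal.add_ne_top (ha i) h2⟩
    exact (EReal.continuousAt_add (p := (a i, ∑ i ∈ s, a i)) (Or.inl (ha i)) (Or.inr h2)).tendsto.comp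
      ((hf i (Finset.mem_insert_self _ _)).prodMk_nhds h1)

open Filter Topology in
lemma tauN_le {X : Type*} [TopologicalSpace X] [CompactSpace X] [T2Space X]
    (β : C(X, X)) (A : C(X, ℝ) →ₗ[ℝ] C(X, ℝ)) (n : ℕ)
    (hB_pos : ∀ f : C(X, ℝ), 0 ≤ f → 0 ≤ (A ^ n) f)
    (hB_hom : ∀ f g : C(X, ℝ), (A ^ n) ((f.comp β) * g) = f * (A ^ n) g)
    (μ : C(X, ℝ) →ₗ[ℝ] ℝ) (hμ : IsPosNormalized μ)
    (hμinv : ∀ f : C(X, ℝ), μ (f.comp β) = μ f)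
    (D : Finset C(X, ℝ)) (hD : IsPartitionOfUnity D) :
    tauN A μ n ≤ ∑ g ∈ D, tSummand (μ g) (μ ((A ^ n) g)) := by
  have hlim1 := tendsto_sum_EReal (l := 𝓝[>] (0 : ℝ)) D
    (fun g δ => ((μ g * Real.log ((μ ((A ^ n) g) + δ) / μ g) : ℝ) : EReal))
    (fun g => tSummand (μ g) (μ ((A ^ n) g))) (fun g => tSummand_ne_top _ _)
    (fun g hg => tendsto_tSummand (hμ.1 g (hD.1 g hg)) (hμ.1 _ (hB_pos g (hD.1 g hg))))
  have hlim2 : Tendsto (fun δ : ℝ => ((2 * δ : ℝ) : EReal)) (𝓝[>] 0) (𝓝 ((0 : ℝ) : EReal)) := by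
    rw [EReal.tendsto_coe]
    have : Tendsto (fun δ : ℝ => 2 * δ) (𝓝 0) (𝓝 (2 * 0)) := Continuous.tendsto (by fun_prop) 0
    simpa using this.mono_left nhdsWithin_le_nhds
  have hlim := (EReal.continuousAt_add
    (p := (∑ g ∈ D, tSummand (μ g) (μ ((A ^ n) g)), ((0 : ℝ) : EReal)))
    (Or.inl hlim1.2) (Or.inr (EReal.coe_ne_top _))).tendsto.comp (hlim1.1.prodMk_nhds hlim2)
  simp only [EReal.coe_zero, add_zero] at hlim
  refine ge_of_tendsto hlim ?_
  filter_upwards [self_mem_nhdsWithin] with δ hδ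
  obtain ⟨D', hD', hb⟩ := main_bound β (A ^ n) hB_pos hB_hom μ hμ hμinv D hD hδ
  refine (iInf₂_le D' hD').trans ((iSup₂_le hb).trans (le_of_eq ?_))
  rw [EReal.coe_add, coe_sum_EReal]
  rfl

lemma iterate_facts {X : Type*} [TopologicalSpace X]
    (α : C(X, X)) (A : C(X, ℝ) →ₗ[ℝ] C(X, ℝ))
    (hA_pos : ∀ f : C(X, ℝ), 0 ≤ f → 0 ≤ A f)
    (hA_hom : ∀ f g : C(X, ℝ), A ((f.comp α) * g) = f * A g)
    (μ : C(X, ℝ) →ₗ[ℝ] ℝ)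
    (hμinv : ∀ f : C(X, ℝ), μ (f.comp α) = μ f) (n : ℕ) :
    ∃ β : C(X, X), (∀ f : C(X, ℝ), 0 ≤ f → 0 ≤ (A ^ n) f) ∧
      (∀ f g : C(X, ℝ), (A ^ n) ((f.comp β) * g) = f * (A ^ n) g) ∧
      (∀ f : C(X, ℝ), μ (f.comp β) = μ f) := by
  induction n with
  | zero => exact ⟨ContinuousMap.id X, by simp, by simp, by simp⟩
  | succ n ih =>
    obtain ⟨β, h1, h2, h3⟩ := ih
    refine ⟨α.comp β, ?_, ?_, ?_⟩
    · intro f hf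
      rw [pow_succ', Module.End.mul_apply]
      exact hA_pos _ (h1 f hf)
    · intro f g
      rw [pow_succ', Module.End.mul_apply, Module.End.mul_apply, ← ContinuousMap.comp_assoc, h2,
        hA_hom]
    · intro f
      rw [← ContinuousMap.comp_assoc, h3, hμinv]

/-- **Theorem 1.2.** For an `α`-invariant probability measure `μ`, in the definition of the
`t`-entropy one may simply evaluate at `m = μ` instead of taking the supremum over `m`:
`τ(μ) = inf_{n, D} (1/n) Σ_{g ∈ D} μ(g) ln(μ(Aⁿg)/μ(g))`. -/
theorem tEntropy_eq_inf_eval_at_mu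
    {X : Type*} [TopologicalSpace X] [CompactSpace X] [T2Space X]
    (α : C(X, X)) (A : C(X, ℝ) →ₗ[ℝ] C(X, ℝ))
    (hA_pos : ∀ f : C(X, ℝ), 0 ≤ f → 0 ≤ A f)
    (hA_hom : ∀ f g : C(X, ℝ), A ((f.comp α) * g) = f * A g)
    (μ : C(X, ℝ) →ₗ[ℝ] ℝ) (hμ : IsPosNormalized μ)
    (hμinv : ∀ f : C(X, ℝ), μ (f.comp α) = μ f) :
    tEntropy A μ =
      ⨅ (n : ℕ+) (D : Finset C(X, ℝ)) (_ : IsPartitionOfUnity D),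
        ((((n : ℕ) : ℝ))⁻¹ : EReal) * ∑ g ∈ D, tSummand (μ g) (μ ((A ^ (n : ℕ)) g)) := by
  unfold tEntropy
  apply le_antisymm
  · refine le_iInf fun n => le_iInf fun D => le_iInf fun hD => ?_
    obtain ⟨β, h1, h2, h3⟩ := iterate_facts α A hA_pos hA_hom μ hμinv n
    refine (iInf_le _ n).trans ?_
    refine mul_le_mul_of_nonneg_left (tauN_le β A n h1 h2 μ hμ h3 D hD) ?_
    exact EReal.inv_nonneg_of_nonneg (by exact_mod_cast Nat.zero_le _)
  · refine le_iInf fun n => ?_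
    refine (iInf_le _ n).trans ?_
    have hn : (0 : EReal) < (((n : ℕ) : ℝ) : EReal) := by exact_mod_cast n.pos
    have hn' : (((n : ℕ) : ℝ) : EReal) ≠ ⊤ := EReal.coe_ne_top _
    rw [mul_comm, ← div_eq_mul_inv, EReal.le_div_iff_mul_le hn hn']
    refine le_iInf fun D => le_iInf fun hD => ?_
    rw [← EReal.le_div_iff_mul_le hn hn']
    refine (iInf₂_le D hD).trans ?_
    rw [mul_comm, ← div_eq_mul_inv]
    exact EReal.div_le_div_right_of_nonneg hn.le
      (le_iSup₂ (f := fun (m : C(X, ℝ) →ₗ[ℝ] ℝ) (_ : IsPosNormalized m) =>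
        ∑ g ∈ D, tSummand (μ g) (m ((A ^ (n : ℕ)) g))) μ hμ)
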